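/- Fix an integer s ≥ 3. There exists N such that for all integers n ≥ N and all k with 3 ≤ k ≤ n^{1/2 − 1/s}, the choice number of the Kneser graph satisfies ch(KG_{n,k}) ≥ (1/(2s²))·n·log₂ n. Equivalently, there exists an assignment of lists of size ⌊(1/(2s²))·n·log₂ n⌋ to the k-element subsets of [n] for which no proper coloring of KG_{n,k} respecting the lists exists. -/

import Mathlib

/-- The Kneser graph `KG_{n,k}`: vertices are the `k`-element subsets of `[n]`,
adjacent iff disjoint. -/
def KneserGraph (n k : ℕ) : SimpleGraph {v : Finset (Fin n) // v.card = k} :=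
  SimpleGraph.fromRel (fun u v => Disjoint u.1 v.1)

/-- `G` is `s`-choosable: every assignment of lists of size `s` admits a proper coloring
from the lists. -/
def Choosable {V : Type*} (G : SimpleGraph V) (s : ℕ) : Prop :=
  ∀ S : V → Finset ℕ, (∀ v, (S v).card = s) →
    ∃ c : V → ℕ, (∀ v, c v ∈ S v) ∧ ∀ u v, G.Adj u v → c u ≠ c v

/-- The choice number of `G`: the least `s` such that `G` is `s`-choosable. -/
noncomputable def choiceNumber {V : Type*} (G : SimpleGraph V) : ℕ :=
  sInf {s | Choosable G s}

theorem le_add_mul_of_antitone_sub (f : ℕ → ℝ) (hf : Antitone fun i => f i - f (i + 1)) (a b : ℕ) :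
    f b ≤ f a + ((a : ℝ) - b) * (f b - f (b + 1)) := by
  rcases le_total b a with h | h
  · induction a, h using Nat.le_induction with
    | base => simp
    | succ a hba ih =>
      have := hf hba
      simp only at this
      push_cast
      linarith
  · induction h using Nat.decreasingInduction with
    | self => simp
    | of_succ a hab ih =>
      have := hf hab.le
      simp only at this
      push_cast at ih ⊢
      linarith

theorem antitone_choose_sub (N t : ℕ) (ht : 0 < t) :
    Antitone fun i => ((N - i).choose t : ℝ) - ((N - (i + 1)).choose t : ℝ) := by
  obtain ⟨r, rfl⟩ : ∃ r, t = r + 1 := ⟨t - 1, by omega⟩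
  have key (i : ℕ) : ((N - i).choose (r + 1) : ℝ) - ((N - (i + 1)).choose (r + 1) : ℝ) =
      if i < N then ((N - (i + 1)).choose r : ℝ) else 0 := by
    split_ifs with h
    · obtain ⟨d, hd⟩ : ∃ d, N - i = d + 1 := ⟨N - i - 1, by omega⟩
      have hd' : N - (i + 1) = d := by omega
      rw [hd, hd', Nat.choose_succ_succ]
      push_cast
      ring
    · simp [show N - i = 0 by omega, show N - (i + 1) = 0 by omega]
  intro i j hij
  simp only [key]
  split_ifs with h1 h2
  · exact_mod_cast Nat.choose_le_choose r (by omega)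
  · omega
  · positivity
  · exact le_rfl

theorem centralBinom_mul_le_two_pow_mul_choose (t b : ℕ) (hbt : b ≤ t) :
    ((2 * t).choose t : ℝ) * (t - b ^ 2) ≤ t * (2 ^ b * ((2 * t - b).choose t : ℝ)) := by
  induction b with
  | zero => simp [mul_comm]
  | succ i ih =>
    have ih := ih (by omega)
    have h : ((2 * t - (i + 1)).choose t : ℝ) * (2 * t - i) =
        ((2 * t - i).choose t : ℝ) * (t - i) := by
      obtain ⟨d, hd⟩ : ∃ d, 2 * t - i = d + 1 := ⟨2 * t - i - 1, by omega⟩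
      have h0 := Nat.choose_mul_succ_eq d t
      rw [show 2 * t - (i + 1) = d by omega, hd]
      have h1 : ((d.choose t : ℕ) : ℝ) * ((d : ℝ) + 1) =
          ((d + 1).choose t : ℝ) * ((d + 1 - t : ℕ) : ℝ) := by exact_mod_cast h0
      have h2 : ((d + 1 - t : ℕ) : ℝ) = (t : ℝ) - i := by
        rw [show d + 1 - t = t - i by omega, Nat.cast_sub (by omega)]
      have h3 : (d : ℝ) + 1 = 2 * t - i := by
        have : ((d + 1 + i : ℕ) : ℝ) = ((2 * t : ℕ) : ℝ) := by congr 1; omega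
        push_cast at this
        linarith
      rw [← h2, ← h3]
      exact h1
    have hit : (i : ℝ) + 1 ≤ t := by exact_mod_cast hbt
    have hi : (0 : ℝ) ≤ i := by positivity
    have hC : (0 : ℝ) ≤ ((2 * t).choose t : ℝ) := by positivity
    have hC' : (0 : ℝ) ≤ ((2 * t - (i + 1)).choose t : ℝ) := by positivity
    have hstep : ((2 * t - i).choose t : ℝ) * (t - i) ≤
        2 * t * ((2 * t - (i + 1)).choose t : ℝ) := by nlinarith
    have hpos : (0 : ℝ) < t := by linarith
    have h4 : ((2 * t).choose t : ℝ) * (t - i ^ 2) * (t - i) ≤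
        t * (t * (2 ^ (i + 1) * ((2 * t - (i + 1)).choose t : ℝ))) := by
      calc ((2 * t).choose t : ℝ) * (t - i ^ 2) * (t - i)
          ≤ t * (2 ^ i * ((2 * t - i).choose t : ℝ)) * (t - i) :=
            mul_le_mul_of_nonneg_right ih (by linarith)
        _ = t * 2 ^ i * (((2 * t - i).choose t : ℝ) * (t - i)) := by ring
        _ ≤ t * 2 ^ i * (2 * t * ((2 * t - (i + 1)).choose t : ℝ)) := by gcongr
        _ = _ := by ring
    refine le_of_mul_le_mul_left (le_trans ?_ h4) hpos
    push_cast
    have : (t : ℝ) * (t - (i + 1) ^ 2) ≤ (t - i ^ 2) * (t - i) := by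
      nlinarith [pow_nonneg hi 3, mul_nonneg hi hpos.le]
    nlinarith [mul_le_mul_of_nonneg_left this hC]

theorem centralBinom_le_two_pow_mul_choose (t b : ℕ) (ht : 0 < t) (hbt : 2 * b ^ 2 ≤ t) :
    ((2 * t).choose t : ℝ) ≤ 2 * 2 ^ b * ((2 * t - b).choose t : ℝ) := by
  have h := centralBinom_mul_le_two_pow_mul_choose t b (by nlinarith)
  have h2 : (2 : ℝ) * b ^ 2 ≤ t := by exact_mod_cast hbt
  have hpos : (0 : ℝ) < t := by exact_mod_cast ht
  have hC : (0 : ℝ) ≤ ((2 * t).choose t : ℝ) := by positivity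
  refine le_of_mul_le_mul_left ?_ hpos
  nlinarith [mul_le_mul_of_nonneg_left h2 hC]

theorem choose_sub_mul_pow_le (n k j : ℕ) (hkn : k ≤ n) (hjk : j ≤ k) :
    (n - j).choose (k - j) * n ^ j ≤ k ^ j * n.choose k := by
  induction j with
  | zero => simp
  | succ i ih =>
    have ih := ih (by omega)
    obtain ⟨d, hd⟩ : ∃ d, n - i = d + 1 := ⟨n - i - 1, by omega⟩
    obtain ⟨e, he⟩ : ∃ e, k - i = e + 1 := ⟨k - i - 1, by omega⟩
    rw [show n - (i + 1) = d by omega, show k - (i + 1) = e by omega]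
    rw [hd, he] at ih
    have h := Nat.add_one_mul_choose_eq d e
    have hr : n * (e + 1) ≤ k * (d + 1) := by
      obtain rfl : n = d + 1 + i := by omega
      obtain rfl : k = e + 1 + i := by omega
      nlinarith
    refine Nat.le_of_mul_le_mul_left ?_ (Nat.succ_pos d)
    calc (d + 1) * (d.choose e * n ^ (i + 1))
        = ((d + 1) * d.choose e) * n ^ i * n := by ring
      _ = ((d + 1).choose (e + 1) * n ^ i) * (n * (e + 1)) := by rw [h]; ring
      _ ≤ (k ^ i * n.choose k) * (k * (d + 1)) := Nat.mul_le_mul ih hr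
      _ = _ := by rw [Nat.succ_eq_add_one]; ring

theorem Choosable.mono {V : Type*} {G : SimpleGraph V} {a b : ℕ} (hab : a ≤ b)
    (h : Choosable G a) : Choosable G b := by
  intro S hS
  choose T hT hTc using fun v => Finset.exists_subset_card_eq (s := S v) (hab.trans (hS v).ge)
  obtain ⟨c, hc, hc'⟩ := h T hTc
  exact ⟨c, fun v => hT v (hc v), hc'⟩

theorem choosable_card {V : Type*} [Fintype V] (G : SimpleGraph V) :
    Choosable G (Fintype.card V) := by
  classical
  intro S hS
  obtain ⟨c, hc, hc'⟩ := (Finset.all_card_le_biUnion_card_iff_exists_injective S).1 (by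
    intro s
    rcases s.eq_empty_or_nonempty with rfl | ⟨v, hv⟩
    · simp
    · exact (s.card_le_univ.trans (hS v).ge).trans
        (Finset.card_le_card (Finset.subset_biUnion_of_mem S hv)))
  exact ⟨c, hc', fun u v huv h => huv.ne (hc h)⟩

theorem lt_choiceNumber {V : Type*} [Fintype V] {G : SimpleGraph V} {t : ℕ}
    (h : ¬ Choosable G t) : t < choiceNumber G := by
  by_contra! hle
  exact h ((Nat.sInf_mem (s := {s | Choosable G s}) ⟨_, choosable_card G⟩).mono hle)

theorem not_choosable_of_containers {V Ω : Type*} [Fintype V] [DecidableEq V] [Fintype Ω]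
    (G : SimpleGraph V)
    (K : Ω → Finset V) (t b : ℕ) (ht : 0 < t) (hbt : 2 * b ^ 2 ≤ t)
    (hK : ∀ I : Finset V, (∀ u ∈ I, ∀ v ∈ I, ¬ G.Adj u v) → ∃ ω, I ⊆ K ω)
    (hsize : ∀ ω, 2 * t * (K ω).card ≤ b * Fintype.card V)
    (hcount : 2 * t * Real.log (Fintype.card Ω) * (2 * 2 ^ b) < Fintype.card V) :
    ¬ Choosable G t := by
  classical
  intro hch
  let L := Finset.powersetCard t (Finset.range (2 * t))
  let C : (Fin (2 * t) → Ω) → V → Finset ℕ := fun ω v =>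
    (Finset.univ.filter fun i : Fin (2 * t) => v ∈ K (ω i)).map Fin.valEmbedding
  let good : (Fin (2 * t) → Ω) → V → Finset (Finset ℕ) := fun ω v =>
    L.filter fun S => ¬ Disjoint S (C ω v)
  have hLcard : L.card = (2 * t).choose t := by simp [L]
  have hC (ω v) : C ω v ⊆ Finset.range (2 * t) := by
    intro i hi
    simp only [C, Finset.mem_map, Finset.mem_filter] at hi
    obtain ⟨j, -, rfl⟩ := hi
    simp
  have hgood (ω v) : ((good ω v).card : ℝ) =
      (2 * t).choose t - (2 * t - (C ω v).card).choose t := by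
    have h1 : (L.filter fun S => Disjoint S (C ω v)) =
        Finset.powersetCard t (Finset.range (2 * t) \ C ω v) := by
      ext S
      simp only [L, Finset.mem_filter, Finset.mem_powersetCard, Finset.subset_sdiff]
      tauto
    have h2 := Finset.card_filter_add_card_filter_not (s := L) fun S => Disjoint S (C ω v)
    rw [h1, Finset.card_powersetCard, Finset.card_sdiff_of_subset (hC ω v), Finset.card_range,
      hLcard] at h2
    rw [← h2]
    simp [good]
  have hcover : Fintype.piFinset (fun _ : V => L) ⊆
      Finset.univ.biUnion fun ω => Fintype.piFinset (good ω) := by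
    intro S hS
    rw [Fintype.mem_piFinset] at hS
    have hS' (v) := Finset.mem_powersetCard.1 (hS v)
    obtain ⟨c, hc, hcG⟩ := hch S fun v => (hS' v).2
    choose ω hω using fun i : Fin (2 * t) =>
      hK (Finset.univ.filter fun v => c v = i) (by
        intro u hu v hv huv
        simp only [Finset.mem_filter, Finset.mem_univ, true_and] at hu hv
        exact hcG u v huv (hu.trans hv.symm))
    simp only [Finset.mem_biUnion, Finset.mem_univ, true_and, Fintype.mem_piFinset]
    refine ⟨ω, fun v => ?_⟩
    simp only [good, Finset.mem_filter, hS v, true_and, Finset.not_disjoint_iff]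
    refine ⟨c v, hc v, ?_⟩
    have hlt : c v < 2 * t := Finset.mem_range.1 ((hS' v).1 (hc v))
    simp only [C, Finset.mem_map, Finset.mem_filter, Finset.mem_univ, true_and]
    exact ⟨⟨c v, hlt⟩, hω ⟨c v, hlt⟩ (by simp), rfl⟩
  have hN : (0 : ℝ) < (2 * t).choose t := by exact_mod_cast Nat.choose_pos (by omega)
  have hsum (ω) : (Fintype.card V : ℝ) ≤
      ∑ v, 2 * 2 ^ b * (((2 * t - (C ω v).card).choose t : ℝ) / (2 * t).choose t) := by
    have h1 : ∑ v, (C ω v).card ≤ b * Fintype.card V := by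
      have : ∑ v, (C ω v).card = ∑ i, (K (ω i)).card := by
        simp only [C, Finset.card_map]
        refine (Finset.sum_card_bipartiteAbove_eq_sum_card_bipartiteBelow
          (fun v i => v ∈ K (ω i))).trans ?_
        simp [Finset.bipartiteBelow]
      rw [this]
      refine Nat.le_of_mul_le_mul_left ?_ (show 0 < 2 * t by omega)
      rw [Finset.mul_sum]
      refine (Finset.sum_le_sum fun i _ => hsize (ω i)).trans ?_
      simp
    have h2 (v) := le_add_mul_of_antitone_sub _ (antitone_choose_sub (2 * t) t ht) (C ω v).card b
    set d : ℝ := ((2 * t - b).choose t : ℝ) - ((2 * t - (b + 1)).choose t : ℝ) with hd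
    have hd0 : 0 ≤ d := sub_nonneg.2 (by exact_mod_cast Nat.choose_le_choose t (by omega))
    have h3 : (Fintype.card V : ℝ) * (2 * t - b).choose t ≤
        ∑ v, ((2 * t - (C ω v).card).choose t : ℝ) := by
      have h4 := Finset.sum_le_sum fun v (_ : v ∈ Finset.univ) => h2 v
      rw [Finset.sum_add_distrib, ← Finset.sum_mul, Finset.sum_sub_distrib] at h4
      simp only [Finset.sum_const, Finset.card_univ, nsmul_eq_mul] at h4
      have h5 : (∑ v, ((C ω v).card : ℝ)) - Fintype.card V * b ≤ 0 := by
        have : ((∑ v, (C ω v).card : ℕ) : ℝ) ≤ ((b * Fintype.card V : ℕ) : ℝ) := by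
          exact_mod_cast h1
        push_cast at this
        linarith
      linarith [mul_nonpos_of_nonpos_of_nonneg h5 hd0]
    have h6 := centralBinom_le_two_pow_mul_choose t b ht hbt
    rw [← Finset.mul_sum, ← Finset.sum_div, ← mul_div_assoc, le_div_iff₀ hN]
    calc (Fintype.card V : ℝ) * (2 * t).choose t
        ≤ Fintype.card V * (2 * 2 ^ b * ((2 * t - b).choose t : ℝ)) := by gcongr
      _ = 2 * 2 ^ b * (Fintype.card V * (2 * t - b).choose t) := by ring
      _ ≤ _ := by gcongr
  have hprod (ω) : ((Fintype.piFinset (good ω)).card : ℝ) ≤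
      ((2 * t).choose t : ℝ) ^ Fintype.card V *
        Real.exp (-(Fintype.card V / (2 * 2 ^ b))) := by
    rw [Fintype.card_piFinset]
    push_cast
    calc ∏ v, ((good ω v).card : ℝ)
        ≤ ∏ v, ((2 * t).choose t : ℝ) *
            Real.exp (-(((2 * t - (C ω v).card).choose t : ℝ) / (2 * t).choose t)) := by
          refine Finset.prod_le_prod (fun _ _ => by positivity) fun v _ => ?_
          rw [hgood]
          have := Real.one_sub_le_exp_neg
            (((2 * t - (C ω v).card).choose t : ℝ) / (2 * t).choose t)
          calc _ = ((2 * t).choose t : ℝ) *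
                (1 - ((2 * t - (C ω v).card).choose t : ℝ) / (2 * t).choose t) := by
                field_simp
            _ ≤ _ := by gcongr
      _ = ((2 * t).choose t : ℝ) ^ Fintype.card V * Real.exp
            (-∑ v, (((2 * t - (C ω v).card).choose t : ℝ) / (2 * t).choose t)) := by
          rw [Finset.prod_mul_distrib, ← Real.exp_sum, Finset.sum_neg_distrib]
          simp
      _ ≤ _ := by
          gcongr
          rw [div_le_iff₀ (by positivity), mul_comm, Finset.mul_sum]
          exact hsum ω
  have hΩ : 0 < Fintype.card Ω := Fintype.card_pos_iff.2 ⟨(hK ∅ (by simp)).choose⟩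
  have htotal : ((2 * t).choose t : ℝ) ^ Fintype.card V ≤
      (Fintype.card Ω : ℝ) ^ (2 * t) * (((2 * t).choose t : ℝ) ^ Fintype.card V *
        Real.exp (-(Fintype.card V / (2 * 2 ^ b)))) := by
    have h1 := (Finset.card_le_card hcover).trans Finset.card_biUnion_le
    rw [Fintype.card_piFinset] at h1
    have h2 : ((∏ _v : V, L.card : ℕ) : ℝ) ≤
        ((∑ ω, (Fintype.piFinset (good ω)).card : ℕ) : ℝ) := by exact_mod_cast h1
    push_cast at h2
    refine le_trans (by simp [hLcard]) (h2.trans ((Finset.sum_le_sum fun ω _ => hprod ω).trans ?_))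
    simp
  have hNV : (0 : ℝ) < ((2 * t).choose t : ℝ) ^ Fintype.card V := by positivity
  have h1 : (1 : ℝ) ≤ (Fintype.card Ω : ℝ) ^ (2 * t) *
      Real.exp (-(Fintype.card V / (2 * 2 ^ b))) := by
    refine le_of_mul_le_mul_left ?_ hNV
    linarith
  have hlog : (Fintype.card Ω : ℝ) ^ (2 * t) =
      Real.exp (2 * t * Real.log (Fintype.card Ω)) := by
    rw [mul_comm _ (Real.log _), Real.exp_mul, Real.exp_log (by exact_mod_cast hΩ)]
    exact_mod_cast rfl
  rw [hlog, ← Real.exp_add, Real.one_le_exp_iff] at h1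
  have h2 : 2 * t * Real.log (Fintype.card Ω) < Fintype.card V / (2 * 2 ^ b) := by
    rw [lt_div_iff₀ (by positivity)]
    exact hcount
  linarith

theorem card_filter_subset_subtype (n k : ℕ) (T : Finset (Fin n)) (hT : T.card ≤ k) :
    (Finset.univ.filter fun v : {v : Finset (Fin n) // v.card = k} => T ⊆ v.1).card =
      (n - T.card).choose (k - T.card) := by
  rw [← Finset.card_map (Function.Embedding.subtype _)]
  have h := Finset.card_filter_powersetCard_subset T Finset.univ k T.subset_univ hT
  rw [Finset.card_univ, Fintype.card_fin] at h
  rw [← h]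
  congr 1
  ext v
  simp only [Finset.mem_map, Finset.mem_filter, Finset.mem_univ, true_and,
    Function.Embedding.subtype_apply, Finset.mem_powersetCard, Finset.subset_univ]
  constructor
  · rintro ⟨u, hu, rfl⟩
    exact ⟨u.2, hu⟩
  · rintro ⟨hv, hT⟩
    exact ⟨⟨v, hv⟩, hT, rfl⟩

theorem card_le_of_not_disjoint (n k c : ℕ) (𝒱 : Finset {v : Finset (Fin n) // v.card = k})
    (T U : Finset (Fin n)) (hU : ∀ v ∈ 𝒱, ¬ Disjoint v.1 U)
    (hc : ∀ x ∈ U, (𝒱.filter fun v => insert x T ⊆ v.1).card ≤ c) :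
    (𝒱.filter fun v => T ⊆ v.1).card ≤ U.card * c := by
  classical
  refine le_trans (Finset.card_le_card ?_) (Finset.card_biUnion_le_card_mul U _ c hc)
  intro v hv
  rw [Finset.mem_filter] at hv
  obtain ⟨x, hxv, hxU⟩ := Finset.not_disjoint_iff.1 (hU v hv.1)
  rw [Finset.mem_biUnion]
  exact ⟨x, hxU, Finset.mem_filter.2 ⟨hv.1, Finset.insert_subset hxv hv.2⟩⟩

theorem card_filter_not_disjoint_mul_le (n k : ℕ) (hk : 0 < k) (hkn : k ≤ n)
    (T : Finset (Fin n)) :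
    (Finset.univ.filter fun v : {v : Finset (Fin n) // v.card = k} => ¬ Disjoint v.1 T).card * n ≤
      T.card * k * n.choose k := by
  have h := card_le_of_not_disjoint n k ((n - 1).choose (k - 1))
    (Finset.univ.filter fun v => ¬ Disjoint v.1 T) ∅ T (by simp) (by
      intro x _
      have h1 := card_filter_subset_subtype n k {x} (by rwa [Finset.card_singleton])
      rw [Finset.card_singleton] at h1
      rw [← h1]
      refine Finset.card_le_card ?_
      intro v
      simp +contextual)
  simp only [Finset.empty_subset, Finset.filter_true] at h
  have h2 := choose_sub_mul_pow_le n k 1 hkn hk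
  simp only [pow_one] at h2
  calc _ ≤ T.card * (n - 1).choose (k - 1) * n := Nat.mul_le_mul_right _ h
    _ = T.card * ((n - 1).choose (k - 1) * n) := by ring
    _ ≤ T.card * (k * n.choose k) := Nat.mul_le_mul_left _ h2
    _ = _ := by ring

theorem card_filter_subset_le_of_no_small_cover (n k m : ℕ) (hmk : m < k)
    (𝒱 : Finset {v : Finset (Fin n) // v.card = k})
    (h : ∀ T : Finset (Fin n), T.card ≤ m → ∃ U : Finset (Fin n), U.card ≤ k ∧ Disjoint T U ∧
      ∀ v ∈ 𝒱, ¬ Disjoint v.1 U) (i : ℕ) :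
    ∀ T : Finset (Fin n), T.card + i = m + 1 → (𝒱.filter fun v => T ⊆ v.1).card ≤
      k ^ i * (n - (m + 1)).choose (k - (m + 1)) := by
  induction i with
  | zero =>
    intro T hT
    have h1 := card_filter_subset_subtype n k T (by omega)
    rw [pow_zero, one_mul, ← hT, add_zero, ← h1]
    exact Finset.card_le_card (Finset.filter_subset_filter _ (Finset.subset_univ _))
  | succ i ih =>
    intro T hT
    obtain ⟨U, hUk, hTU, hU⟩ := h T (by omega)
    refine (card_le_of_not_disjoint n k _ 𝒱 T U hU fun x hx => ih (insert x T) ?_).trans ?_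
    · rw [Finset.card_insert_of_notMem (Finset.disjoint_right.1 hTU hx)]
      omega
    · rw [pow_succ', mul_assoc]
      exact Nat.mul_le_mul_right _ hUk

theorem exists_fin_image_univ_eq {α : Type*} [DecidableEq α] (k : ℕ) (T : Finset α)
    (hT : T.Nonempty) (hk : T.card ≤ k) : ∃ y : Fin k → α, Finset.univ.image y = T := by
  obtain ⟨a, ha⟩ := hT
  refine ⟨fun i => if h : (i : ℕ) < T.card then T.equivFin.symm ⟨i, h⟩ else a, ?_⟩
  ext x
  simp only [Finset.mem_image, Finset.mem_univ, true_and]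
  constructor
  · rintro ⟨i, rfl⟩
    split_ifs
    · exact (T.equivFin.symm _).2
    · exact ha
  · intro hx
    refine ⟨⟨T.equivFin ⟨x, hx⟩, (Fin.is_lt _).trans_le hk⟩, ?_⟩
    simp

/-- The `k`-sets meeting every member of the family of images of `B`. -/
def hittingSets {n m k : ℕ} (B : (Fin m → Fin n) → Fin k → Fin n) :
    Finset {v : Finset (Fin n) // v.card = k} :=
  Finset.univ.filter fun v => ∀ x, ¬ Disjoint v.1 (Finset.univ.image (B x))

theorem hittingSets_card_mul_le {n m k c : ℕ} (hk : 0 < k) (hkn : k ≤ n)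
    (B : (Fin m → Fin n) → Fin k → Fin n) (x : Fin m → Fin n)
    (hx : (Finset.univ.image (B x)).card ≤ c) :
    (hittingSets B).card * n ≤ c * k * n.choose k := by
  refine le_trans ?_ ((card_filter_not_disjoint_mul_le n k hk hkn
    (Finset.univ.image (B x))).trans (by gcongr))
  refine Nat.mul_le_mul_right _ (Finset.card_le_card ?_)
  intro v hv
  simp only [hittingSets, Finset.mem_filter, Finset.mem_univ, true_and] at hv ⊢
  exact hv x

theorem exists_subset_hittingSets_zero {n k : ℕ} (hk : 0 < k) (hkn : k ≤ n)
    (I : Finset {v : Finset (Fin n) // v.card = k})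
    (hI : ∀ u ∈ I, ∀ v ∈ I, ¬ Disjoint u.1 v.1) :
    ∃ B : (Fin 0 → Fin n) → Fin k → Fin n,
      (hittingSets B).card * n ≤ k * k * n.choose k ∧ I ⊆ hittingSets B := by
  have hcard (B : (Fin 0 → Fin n) → Fin k → Fin n) :
      (hittingSets B).card * n ≤ k * k * n.choose k :=
    hittingSets_card_mul_le hk hkn B Fin.elim0 (Finset.card_image_le.trans (by simp))
  rcases I.eq_empty_or_nonempty with rfl | ⟨u, hu⟩
  · exact ⟨fun _ _ => ⟨0, by omega⟩, hcard _, Finset.empty_subset _⟩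
  · obtain ⟨y, hy⟩ := exists_fin_image_univ_eq k u.1 (Finset.card_pos.1 (by rwa [u.2])) u.2.le
    refine ⟨fun _ => y, hcard _, fun v hv => ?_⟩
    simp only [hittingSets, Finset.mem_filter, Finset.mem_univ, true_and, hy]
    exact fun _ => hI v hv u hu

theorem exists_subset_hittingSets {n k m : ℕ} (hm : 0 < m) (hmk : m < k) (hkn : k ≤ n)
    (hpow : k ^ (2 * (m + 1)) * n ≤ n ^ (m + 1))
    (I : Finset {v : Finset (Fin n) // v.card = k})
    (hI : ∀ u ∈ I, ∀ v ∈ I, ¬ Disjoint u.1 v.1) :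
    ∃ B : (Fin m → Fin n) → Fin k → Fin n,
      (hittingSets B).card * n ≤ m * k * n.choose k ∧ I ⊆ hittingSets B := by
  classical
  have hk : 0 < k := by omega
  by_cases hcov : ∃ x : Fin m → Fin n, ∀ u ∈ I, ¬ Disjoint u.1 (Finset.univ.image x)
  · obtain ⟨x, hx⟩ := hcov
    have hxm : (Finset.univ.image x).card ≤ m := Finset.card_image_le.trans (by simp)
    have : Nonempty (Fin m) := ⟨⟨0, hm⟩⟩
    obtain ⟨y, hy⟩ := exists_fin_image_univ_eq k (Finset.univ.image x)
      (Finset.univ_nonempty.image x) (by omega)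
    refine ⟨fun _ => y, hittingSets_card_mul_le hk hkn _ x (by rwa [hy]), fun v hv => ?_⟩
    simp only [hittingSets, Finset.mem_filter, Finset.mem_univ, true_and, hy]
    exact fun _ => hx v hv
  · push Not at hcov
    choose u hu hux using hcov
    choose B hB using fun x => exists_fin_image_univ_eq k (u x).1
      (Finset.card_pos.1 (by rwa [(u x).2])) (u x).2.le
    refine ⟨B, ?_, fun v hv => ?_⟩
    · have h1 := card_filter_subset_le_of_no_small_cover n k m hmk (hittingSets B) (by
        intro T hT
        obtain ⟨T', hTT', hT'⟩ : ∃ T', T ⊆ T' ∧ T'.card = m :=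
          Finset.exists_superset_card_eq hT (by simp; omega)
        obtain ⟨x, hx⟩ := exists_fin_image_univ_eq m T' (Finset.card_pos.1 (by omega)) hT'.le
        refine ⟨(u x).1, (u x).2.le, ?_, fun v hv => ?_⟩
        · exact (Finset.disjoint_of_subset_right (hTT'.trans hx.ge) (hux x)).symm
        · simp only [hittingSets, Finset.mem_filter, Finset.mem_univ, true_and] at hv
          simpa only [hB] using hv x) (m + 1) ∅ (by simp)
      simp only [Finset.empty_subset, Finset.filter_true] at h1
      have h2 := choose_sub_mul_pow_le n k (m + 1) hkn hmk
      have hn : 0 < n ^ (m + 1) := pow_pos (by omega) _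
      refine Nat.le_of_mul_le_mul_left ?_ hn
      calc n ^ (m + 1) * ((hittingSets B).card * n)
          ≤ n ^ (m + 1) * (k ^ (m + 1) * (n - (m + 1)).choose (k - (m + 1)) * n) := by gcongr
        _ = k ^ (m + 1) * n * ((n - (m + 1)).choose (k - (m + 1)) * n ^ (m + 1)) := by ring
        _ ≤ k ^ (m + 1) * n * (k ^ (m + 1) * n.choose k) := by gcongr
        _ = k ^ (2 * (m + 1)) * n * n.choose k := by ring
        _ ≤ n ^ (m + 1) * n.choose k := by gcongr
        _ = n ^ (m + 1) * (1 * n.choose k) := by ring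
        _ ≤ n ^ (m + 1) * (m * k * n.choose k) := by
          gcongr
          exact Nat.mul_pos hm hk
    · simp only [hittingSets, Finset.mem_filter, Finset.mem_univ, true_and]
      intro x
      rw [hB]
      exact hI v hv _ (hu x)

theorem KneserGraph.not_choosable {n k m κ t b : ℕ} (hk : 0 < k) (hkn : k ≤ n)
    (hcont : ∀ I : Finset {v : Finset (Fin n) // v.card = k},
      (∀ u ∈ I, ∀ v ∈ I, ¬ Disjoint u.1 v.1) → ∃ B : (Fin m → Fin n) → Fin k → Fin n,
        (hittingSets B).card * n ≤ κ * k * n.choose k ∧ I ⊆ hittingSets B)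
    (ht : 0 < t) (hbt : 2 * b ^ 2 ≤ t) (hb : 2 * t * (κ * k) ≤ b * n)
    (hcount : 2 * t * (k * n ^ m * Real.log n) * (2 * 2 ^ b) < n.choose k) :
    ¬ Choosable (KneserGraph n k) t := by
  classical
  have hcard : Fintype.card {v : Finset (Fin n) // v.card = k} = n.choose k := by
    rw [Fintype.card_finset_len, Fintype.card_fin]
  let Ω := {B : (Fin m → Fin n) → Fin k → Fin n //
    (hittingSets B).card * n ≤ κ * k * n.choose k}
  have hΩ : Fintype.card Ω ≤ (n ^ k) ^ n ^ m :=
    (Fintype.card_subtype_le _).trans (by simp)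
  refine not_choosable_of_containers (Ω := Ω) _ (fun B => hittingSets B.1) t b ht hbt ?_ ?_ ?_
  · intro I hI
    obtain ⟨B, hB, hIB⟩ := hcont I (by
      intro u hu v hv huv
      refine hI u hu v hv ?_
      rw [KneserGraph, SimpleGraph.fromRel_adj]
      refine ⟨?_, Or.inl huv⟩
      rintro rfl
      have := u.2
      rw [disjoint_self.1 huv] at this
      simp at this
      omega)
    exact ⟨⟨B, hB⟩, hIB⟩
  · intro B
    rw [hcard]
    refine Nat.le_of_mul_le_mul_right ?_ (show 0 < n by omega)
    calc 2 * t * (hittingSets B.1).card * n = 2 * t * ((hittingSets B.1).card * n) := by ring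
      _ ≤ 2 * t * (κ * k * n.choose k) := Nat.mul_le_mul_left _ B.2
      _ = 2 * t * (κ * k) * n.choose k := by ring
      _ ≤ b * n * n.choose k := Nat.mul_le_mul_right _ hb
      _ = _ := by ring
  · rw [hcard]
    refine lt_of_le_of_lt ?_ hcount
    have hlog : Real.log (Fintype.card Ω) ≤ k * n ^ m * Real.log n := by
      rcases Nat.eq_zero_or_pos (Fintype.card Ω) with h0 | h0
      · rw [h0]
        simp only [Nat.cast_zero, Real.log_zero]
        exact mul_nonneg (by positivity) (Real.log_natCast_nonneg n)
      · calc Real.log (Fintype.card Ω) ≤ Real.log (((n : ℝ) ^ k) ^ n ^ m) :=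
              Real.log_le_log (by exact_mod_cast h0) (by exact_mod_cast hΩ)
          _ = _ := by
              rw [Real.log_pow, Real.log_pow]
              push_cast
              ring
    gcongr

theorem KneserGraph.lt_choiceNumber {s n k m κ : ℕ} (hs : 3 ≤ s) (hk : 0 < k) (hkn : k ≤ n)
    (hκ : κ ≤ s ^ 2)
    (hcont : ∀ I : Finset {v : Finset (Fin n) // v.card = k},
      (∀ u ∈ I, ∀ v ∈ I, ¬ Disjoint u.1 v.1) → ∃ B : (Fin m → Fin n) → Fin k → Fin n,
        (hittingSets B).card * n ≤ κ * k * n.choose k ∧ I ⊆ hittingSets B)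
    (hn : 4 * s ^ 2 ≤ n)
    (hkL : 32 * (s : ℝ) ^ 2 * k ^ 2 * Real.logb 2 n ^ 2 ≤ n)
    (hcount : k * (n : ℝ) ^ (m + 1) * Real.logb 2 n ^ 2 * (n : ℝ) ^ ((κ : ℝ) * k / s ^ 2) ≤
      n.choose k) :
    1 / (2 * (s : ℝ) ^ 2) * n * Real.logb 2 n < choiceNumber (KneserGraph n k) := by
  set L := Real.logb 2 n with hL
  set x : ℝ := 1 / (2 * (s : ℝ) ^ 2) * n * L with hx
  have hs' : (3 : ℝ) ≤ s := by exact_mod_cast hs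
  have hs2 : (9 : ℝ) ≤ (s : ℝ) ^ 2 := by nlinarith
  have hn' : 4 * (s : ℝ) ^ 2 ≤ n := by exact_mod_cast hn
  have hn0 : (0 : ℝ) < n := by linarith
  have hk' : (1 : ℝ) ≤ k := by exact_mod_cast hk
  have h2L : (2 : ℝ) ^ L = n := Real.rpow_logb (by norm_num) (by norm_num) hn0
  have hL1 : 1 ≤ L := by
    rw [hL, Real.le_logb_iff_rpow_le (by norm_num) hn0, Real.rpow_one]
    linarith
  have hlog : Real.log n ≤ L := by
    rw [hL, Real.logb, le_div_iff₀ (Real.log_pos (by norm_num))]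
    have := Real.log_two_lt_d9
    nlinarith [Real.log_natCast_nonneg n]
  set b := ⌈(κ : ℝ) * k / s ^ 2 * L⌉₊ with hb
  have hbge : (κ : ℝ) * k / s ^ 2 * L ≤ b := Nat.le_ceil _
  have hblt : (b : ℝ) < (κ : ℝ) * k / s ^ 2 * L + 1 := Nat.ceil_lt_add_one (by positivity)
  have hxn : (n : ℝ) / (2 * s ^ 2) ≤ x := by
    rw [hx]
    calc (n : ℝ) / (2 * s ^ 2) = 1 / (2 * (s : ℝ) ^ 2) * n * 1 := by ring
      _ ≤ _ := by gcongr
  have hns : 1 ≤ (n : ℝ) / (4 * s ^ 2) := by rwa [one_le_div (by positivity)]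
  have hnn : (n : ℝ) / (2 * s ^ 2) = 2 * (n / (4 * s ^ 2)) := by field_simp; norm_num
  have htx : (⌊x⌋₊ : ℝ) ≤ x := Nat.floor_le (by positivity)
  have hxt : x < ⌊x⌋₊ + 1 := Nat.lt_floor_add_one x
  have ht : 0 < ⌊x⌋₊ := Nat.floor_pos.2 (by linarith)
  have hbk : (b : ℝ) ≤ 2 * (k * L) := by
    have h1 : (κ : ℝ) * k / s ^ 2 ≤ k := by
      rw [div_le_iff₀ (by positivity), mul_comm]
      gcongr
      exact_mod_cast hκ
    nlinarith [mul_le_mul_of_nonneg_right h1 (by linarith : 0 ≤ L)]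
  have hbt : 2 * b ^ 2 ≤ ⌊x⌋₊ := by
    have h1 : (b : ℝ) ^ 2 ≤ (2 * (k * L)) ^ 2 := by gcongr
    have h2 : 2 * (2 * (k * L)) ^ 2 ≤ (n : ℝ) / (4 * s ^ 2) := by
      rw [le_div_iff₀ (by positivity)]
      linarith
    have h3 : ((2 * b ^ 2 : ℕ) : ℝ) ≤ (⌊x⌋₊ : ℝ) := by
      push_cast
      linarith
    exact_mod_cast h3
  have hlt : ⌊x⌋₊ < choiceNumber (KneserGraph n k) := by
    refine _root_.lt_choiceNumber (KneserGraph.not_choosable hk hkn hcont ht hbt ?_ ?_)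
    · have h1 : 2 * (⌊x⌋₊ : ℝ) * (κ * k) ≤ b * n := by
        calc 2 * (⌊x⌋₊ : ℝ) * (κ * k) ≤ 2 * x * (κ * k) := by gcongr
          _ = (κ : ℝ) * k / s ^ 2 * L * n := by rw [hx]; field_simp
          _ ≤ _ := by gcongr
      exact_mod_cast h1
    · have h2b : (2 : ℝ) ^ b ≤ 2 * (n : ℝ) ^ ((κ : ℝ) * k / s ^ 2) := by
        calc (2 : ℝ) ^ b = (2 : ℝ) ^ (b : ℝ) := (Real.rpow_natCast _ _).symm
          _ ≤ (2 : ℝ) ^ (L * ((κ : ℝ) * k / s ^ 2) + 1) :=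
            Real.rpow_le_rpow_of_exponent_le (by norm_num) (by linarith)
          _ = _ := by
            rw [Real.rpow_add (by norm_num), Real.rpow_mul (by norm_num), h2L, Real.rpow_one,
              mul_comm]
      refine lt_of_lt_of_le ?_ hcount
      set R := (n : ℝ) ^ ((κ : ℝ) * k / s ^ 2)
      have hRpos : 0 < R := Real.rpow_pos_of_pos hn0 _
      have hLnn : 0 ≤ Real.log n := Real.log_natCast_nonneg n
      calc 2 * (⌊x⌋₊ : ℝ) * (k * (n : ℝ) ^ m * Real.log n) * (2 * 2 ^ b)
          ≤ 2 * x * (k * (n : ℝ) ^ m * L) * (2 * (2 * R)) := by gcongr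
        _ = 4 / (s : ℝ) ^ 2 * (k * (n : ℝ) ^ (m + 1) * L ^ 2 * R) := by
          rw [hx, pow_succ (n : ℝ) m]
          field_simp
          norm_num
        _ < 1 * (k * (n : ℝ) ^ (m + 1) * L ^ 2 * R) := by
          refine mul_lt_mul_of_pos_right ?_ (by positivity)
          rw [div_lt_one (by positivity)]
          linarith
        _ = _ := one_mul _
  have : (⌊x⌋₊ : ℝ) + 1 ≤ choiceNumber (KneserGraph n k) := by exact_mod_cast hlt
  linarith

theorem eventually_mul_sq_logb_le_rpow (c ε : ℝ) (hε : 0 < ε) :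
    ∀ᶠ n : ℕ in Filter.atTop, c * Real.logb 2 n ^ 2 ≤ (n : ℝ) ^ ε := by
  have h := ((isLittleO_log_rpow_rpow_atTop 2 hε).const_mul_left (c / Real.log 2 ^ 2)).bound
    one_pos
  filter_upwards [tendsto_natCast_atTop_atTop.eventually h] with n hn
  rw [one_mul, Real.norm_of_nonneg (by positivity : (0 : ℝ) ≤ (n : ℝ) ^ ε)] at hn
  refine le_trans (le_of_eq ?_) ((Real.le_norm_self _).trans hn)
  rw [Real.logb, div_pow, Real.rpow_two]
  ring

/-- Theorem 2 (lower bound): fix `s ≥ 3`; for all sufficiently large `n` and all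
`3 ≤ k ≤ n^(1/2 - 1/s)`, we have `ch(KG_{n,k}) ≥ (1/(2s²))·n·log₂ n`. -/
theorem stmt_3 (s : ℕ) (hs : 3 ≤ s) :
    ∃ N : ℕ, ∀ n : ℕ, N ≤ n → ∀ k : ℕ, 3 ≤ k →
      (k : ℝ) ≤ (n : ℝ) ^ ((1 : ℝ) / 2 - 1 / (s : ℝ)) →
      (1 / (2 * (s : ℝ) ^ 2)) * n * Real.logb 2 n ≤
        (choiceNumber (KneserGraph n k) : ℝ) := by
  have hs' : (3 : ℝ) ≤ s := by exact_mod_cast hs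
  obtain ⟨N, hN⟩ := Filter.eventually_atTop.1
    (((eventually_mul_sq_logb_le_rpow (32 * (s : ℝ) ^ 2) (2 / s) (by positivity)).and
      (eventually_mul_sq_logb_le_rpow ((2 * (s : ℝ)) ^ (2 * s) * (2 * s)) 1 one_pos)).and
      (Filter.eventually_ge_atTop (4 * s ^ 2)))
  refine ⟨N, fun n hn k hk3 hk => ?_⟩
  obtain ⟨⟨hL1, hL2⟩, hns⟩ := hN n hn
  rw [Real.rpow_one] at hL2
  set L := Real.logb 2 n with hL
  have hk3' : (3 : ℝ) ≤ k := by exact_mod_cast hk3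
  have hn1 : (1 : ℝ) ≤ n := by
    have : 1 ≤ n := by nlinarith
    exact_mod_cast this
  have hn0 : (0 : ℝ) < n := by linarith
  have hL2' : L ^ 2 ≤ n := by
    refine le_trans ?_ hL2
    refine le_mul_of_one_le_left (sq_nonneg L) ?_
    have : (1 : ℝ) ≤ (2 * (s : ℝ)) ^ (2 * s) := one_le_pow₀ (by linarith)
    nlinarith
  have hkpow (i : ℕ) : (k : ℝ) ^ i ≤ (n : ℝ) ^ ((1 / 2 - 1 / (s : ℝ)) * i) := by
    rw [Real.rpow_mul hn0.le, Real.rpow_natCast]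
    gcongr
  have hksq : (k : ℝ) ^ 2 * (n : ℝ) ^ (2 / (s : ℝ)) ≤ n := by
    calc (k : ℝ) ^ 2 * (n : ℝ) ^ (2 / (s : ℝ))
        ≤ (n : ℝ) ^ ((1 / 2 - 1 / (s : ℝ)) * (2 : ℕ)) * (n : ℝ) ^ (2 / (s : ℝ)) := by
          gcongr
          exact hkpow 2
      _ = (n : ℝ) ^ (1 : ℝ) := by
          rw [← Real.rpow_add hn0]
          congr 1
          push_cast
          ring
      _ = n := Real.rpow_one _
  have hkn : k ≤ n := by
    have h1 : (1 : ℝ) ≤ (n : ℝ) ^ (2 / (s : ℝ)) := Real.one_le_rpow hn1 (by positivity)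
    have h2 : (k : ℝ) ≤ n := by nlinarith
    exact_mod_cast h2
  have hkL : 32 * (s : ℝ) ^ 2 * k ^ 2 * L ^ 2 ≤ n := by
    calc 32 * (s : ℝ) ^ 2 * k ^ 2 * L ^ 2 = k ^ 2 * (32 * (s : ℝ) ^ 2 * L ^ 2) := by ring
      _ ≤ _ := le_trans (by gcongr) hksq
  have hchoose : (n : ℝ) ^ k ≤ (k : ℝ) ^ k * n.choose k := by
    have := choose_sub_mul_pow_le n k k hkn le_rfl
    simp only [le_refl, tsub_eq_zero_of_le, Nat.choose_zero_right, one_mul] at this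
    exact_mod_cast this
  have hkk : (0 : ℝ) < (k : ℝ) ^ k := by positivity
  rcases le_or_gt k (2 * s) with hks | hks
  · refine (KneserGraph.lt_choiceNumber (m := 0) (κ := k) hs (by omega) hkn (by nlinarith)
      (exists_subset_hittingSets_zero (by omega) hkn) hns hkL ?_).le
    have hks' : (k : ℝ) ≤ 2 * s := by exact_mod_cast hks
    refine le_of_mul_le_mul_left (le_trans ?_ hchoose) hkk
    calc (k : ℝ) ^ k * (k * (n : ℝ) ^ (0 + 1) * L ^ 2 * (n : ℝ) ^ ((k : ℝ) * k / s ^ 2))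
        = (k : ℝ) ^ k * k * L ^ 2 * (n * (n : ℝ) ^ ((k : ℝ) * k / s ^ 2)) := by ring
      _ ≤ (2 * (s : ℝ)) ^ (2 * s) * (2 * s) * L ^ 2 *
          (n * (n : ℝ) ^ ((k : ℝ) * k / s ^ 2)) := by
          have : (k : ℝ) ^ k ≤ (2 * (s : ℝ)) ^ (2 * s) :=
            (pow_le_pow_left₀ (by positivity) hks' k).trans
              (pow_le_pow_right₀ (by linarith) hks)
          gcongr
      _ ≤ n * (n * (n : ℝ) ^ ((k : ℝ) * k / s ^ 2)) := by gcongr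
      _ = (n : ℝ) ^ (1 + (1 + (k : ℝ) * k / s ^ 2)) := by
          rw [Real.rpow_add hn0, Real.rpow_add hn0, Real.rpow_one]
      _ ≤ (n : ℝ) ^ (k : ℝ) := by
          refine Real.rpow_le_rpow_of_exponent_le hn1 ?_
          have : (k : ℝ) * k / s ^ 2 ≤ k - 2 := by
            rw [div_le_iff₀ (by positivity)]
            nlinarith [mul_nonneg (sub_nonneg.2 hk3') (sub_nonneg.2 hks'),
              mul_nonneg (sub_nonneg.2 hk3')
                (mul_nonneg (sub_nonneg.2 hs') (by positivity : (0 : ℝ) ≤ s + 1)),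
              mul_nonneg (sub_nonneg.2 hs') (by positivity : (0 : ℝ) ≤ s + 3)]
          linarith
      _ = _ := Real.rpow_natCast _ _
  · obtain ⟨m, hm1, hm2⟩ : ∃ m, 2 * m ≤ s ∧ s ≤ 2 * m + 1 := ⟨s / 2, by omega, by omega⟩
    have hm1' : 2 * (m : ℝ) ≤ s := by exact_mod_cast hm1
    have hm2' : (s : ℝ) ≤ 2 * m + 1 := by exact_mod_cast hm2
    have hks' : 2 * (s : ℝ) + 1 ≤ k := by exact_mod_cast hks
    have hpow : k ^ (2 * (m + 1)) * n ≤ n ^ (m + 1) := by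
      have h : (k : ℝ) ^ (2 * (m + 1)) * n ≤ (n : ℝ) ^ (m + 1) := by
        calc (k : ℝ) ^ (2 * (m + 1)) * n
            ≤ (n : ℝ) ^ ((1 / 2 - 1 / (s : ℝ)) * (2 * (m + 1) : ℕ)) * (n : ℝ) ^ (1 : ℝ) := by
              rw [Real.rpow_one]
              gcongr
              exact hkpow _
          _ = (n : ℝ) ^ ((1 / 2 - 1 / (s : ℝ)) * (2 * (m + 1) : ℕ) + 1) :=
              (Real.rpow_add hn0 _ _).symm
          _ ≤ (n : ℝ) ^ ((m + 1 : ℕ) : ℝ) := by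
              refine Real.rpow_le_rpow_of_exponent_le hn1 ?_
              have : 1 ≤ 2 * ((m : ℝ) + 1) / s := by
                rw [one_le_div (by positivity)]
                linarith
              push_cast
              have h2 : (1 / 2 - 1 / (s : ℝ)) * (2 * (m + 1)) = m + 1 - 2 * (m + 1) / s := by
                ring
              linarith
          _ = _ := Real.rpow_natCast _ _
      exact_mod_cast h
    refine (KneserGraph.lt_choiceNumber (m := m) (κ := m) hs (by omega) hkn (by nlinarith)
      (exists_subset_hittingSets (by omega) (by omega) hkn hpow) hns hkL ?_).le
    refine le_of_mul_le_mul_left (le_trans ?_ hchoose) hkk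
    calc (k : ℝ) ^ k * (k * (n : ℝ) ^ (m + 1) * L ^ 2 * (n : ℝ) ^ ((m : ℝ) * k / s ^ 2))
        = (k : ℝ) ^ (k + 1) * (n : ℝ) ^ (m + 1) * L ^ 2 * (n : ℝ) ^ ((m : ℝ) * k / s ^ 2) := by
          ring
      _ ≤ (n : ℝ) ^ ((1 / 2 - 1 / (s : ℝ)) * (k + 1 : ℕ)) * (n : ℝ) ^ (m + 1) * n *
          (n : ℝ) ^ ((m : ℝ) * k / s ^ 2) := by
          gcongr
          exact hkpow _
      _ = (n : ℝ) ^ ((1 / 2 - 1 / (s : ℝ)) * (k + 1 : ℕ) + (m + 1 : ℕ) + 1 +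
          (m : ℝ) * k / s ^ 2) := by
          rw [Real.rpow_add hn0, Real.rpow_add hn0, Real.rpow_add hn0, Real.rpow_one,
            Real.rpow_natCast]
      _ ≤ (n : ℝ) ^ (k : ℝ) := by
          refine Real.rpow_le_rpow_of_exponent_le hn1 ?_
          push_cast
          have h1 : (m : ℝ) * k / s ^ 2 ≤ k / (2 * s) := by
            rw [div_le_div_iff₀ (by positivity) (by positivity)]
            nlinarith [mul_nonneg (sub_nonneg.2 hm1') (by positivity : (0 : ℝ) ≤ k * s)]
          have h2 : (k : ℝ) / (2 * s) - k / s = -(k / s) / 2 := by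
            field_simp
            norm_num
          have h3 : 2 ≤ (k : ℝ) / s := by
            rw [le_div_iff₀ (by positivity)]
            linarith
          have h4 : (0 : ℝ) ≤ 1 / s := by positivity
          have h5 : (1 / 2 - 1 / (s : ℝ)) * (k + 1) = k / 2 + 1 / 2 - k / s - 1 / s := by ring
          linarith
      _ = _ := Real.rpow_natCast _ _
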